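/- The function F(x,y) = (y/x)·exp(y²/(2x²) − 1/x) is a first integral of the foliation defined by Ω₃ = xy dx + (x² + y²)(x dy − y dx) on {x ≠ 0}: writing Ω₃ = P dx + Q dy with P = xy − y(x² + y²) and Q = x(x² + y²), one has F_x · Q − F_y · P = 0 wherever x ≠ 0. -/

import Mathlib

/-- F(x,y) = (y/x)·exp(y²/(2x²) − 1/x) is a first integral of the foliation defined
by Ω₃ = (xy − y(x² + y²)) dx + x(x² + y²) dy on {x ≠ 0}: F_x·Q − F_y·P = 0. -/
theorem firstIntegral_Omega3 (x y : ℂ) (hx : x ≠ 0) :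
    let F : ℂ → ℂ → ℂ := fun x y =>
      (y / x) * Complex.exp (y ^ 2 / (2 * x ^ 2) - 1 / x)
    let P := x * y - y * (x ^ 2 + y ^ 2)
    let Q := x * (x ^ 2 + y ^ 2)
    deriv (fun x' => F x' y) x * Q - deriv (fun y' => F x y') y * P = 0 := by
  intro F P Q
  have hden : (2 : ℂ) * x ^ 2 ≠ 0 := mul_ne_zero two_ne_zero (pow_ne_zero 2 hx)
  have hFx := ((hasDerivAt_const x y).div (hasDerivAt_id x) hx).mul
    (((hasDerivAt_const x (y ^ 2)).div (((hasDerivAt_id x).pow 2).const_mul 2) hden).sub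
      ((hasDerivAt_const x (1 : ℂ)).div (hasDerivAt_id x) hx)).cexp
  have hFy := ((hasDerivAt_id y).div_const x).mul
    ((((hasDerivAt_id y).pow 2).div_const (2 * x ^ 2)).sub_const (1 / x)).cexp
  have hx' : deriv (fun x' => F x' y) x = _ := hFx.deriv
  have hy' : deriv (fun y' => F x y') y = _ := hFy.deriv
  rw [hx', hy']
  simp only [P, Q, Pi.div_apply, Pi.sub_apply, Pi.pow_apply, id]
  generalize Complex.exp _ = E
  field_simp
  ring
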